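/- arXiv:1504.03981 — 2 statements merged into one kernel-verified Lean document; each statement's English description precedes it below -/
import Mathlib

section
/- Let F be a field, V a finite-dimensional vector space over F, and f : V → V a linear endomorphism. Then the characteristic polynomial of f factors as charpoly(f) = X^d · charpoly(f⁺), where d is the dimension of genKer(f) and f⁺ is the nonnilpotent part of f acting on V / genKer(f). -/
/-- The generalized kernel of a linear endomorphism: `⨆ k ≥ 1, ker (f ^ k)`. -/
def genKer {F V : Type*} [Field F] [AddCommGroup V] [Module F V] (f : V →ₗ[F] V) :
    Submodule F V :=
  ⨆ k ≥ 1, LinearMap.ker (f ^ k)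

theorem genKer_le_comap {F V : Type*} [Field F] [AddCommGroup V] [Module F V]
    (f : V →ₗ[F] V) : genKer f ≤ (genKer f).comap f := by
  refine iSup₂_le fun k hk v hv => ?_
  have hfv : f v ∈ LinearMap.ker (f ^ k) := by
    rw [LinearMap.mem_ker] at hv ⊢
    have hcomm : f ^ k * f = f * f ^ k := (pow_succ f k).symm.trans (pow_succ' f k)
    calc (f ^ k) (f v) = (f ^ k * f) v := rfl
      _ = (f * f ^ k) v := by rw [hcomm]
      _ = f ((f ^ k) v) := rfl
      _ = 0 := by rw [hv, map_zero]
  exact Submodule.mem_comap.2 <|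
    (le_iSup₂ (f := fun k (_ : k ≥ 1) => LinearMap.ker (f ^ k)) k hk) hfv

/-- The nonnilpotent part of `f` : the endomorphism induced by `f` on `V ⧸ genKer f`. -/
def nonnilpotentPart {F V : Type*} [Field F] [AddCommGroup V] [Module F V]
    (f : V →ₗ[F] V) : (V ⧸ genKer f) →ₗ[F] (V ⧸ genKer f) :=
  Submodule.mapQ (genKer f) (genKer f) f (genKer_le_comap f)

open Module.Basis in
theorem charpoly_eq_restrict_mul_mapQ {F V : Type*} [Field F] [AddCommGroup V] [Module F V]
    [FiniteDimensional F V] (W : Submodule F V) (e : V →ₗ[F] V) (he : W ≤ W.comap e) :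
    e.charpoly = (e.restrict he).charpoly * (W.mapQ W e he).charpoly := by
  classical
  let m := Module.Free.ChooseBasisIndex F W
  let bW : Module.Basis m F W := Module.Free.chooseBasis F W
  let n := Module.Free.ChooseBasisIndex F (V ⧸ W)
  let bQ : Module.Basis n F (V ⧸ W) := Module.Free.chooseBasis F (V ⧸ W)
  let b := sumQuot bW bQ
  let A : Matrix m m F := LinearMap.toMatrix bW bW (e.restrict he)
  let B : Matrix m n F := Matrix.of fun i l ↦
    ((sumQuot bW bQ).repr (e ((sumQuot bW bQ) (Sum.inr l)))) (Sum.inl i)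
  let D : Matrix n n F := LinearMap.toMatrix bQ bQ (W.mapQ W e he)
  suffices LinearMap.toMatrix b b e = Matrix.fromBlocks A B 0 D by
    rw [← LinearMap.charpoly_toMatrix e b, this, ← LinearMap.charpoly_toMatrix _ bW,
      ← LinearMap.charpoly_toMatrix _ bQ, Matrix.charpoly_fromBlocks_zero₂₁]
  ext u v
  cases u with
  | inl i =>
    cases v with
    | inl k =>
      simp only [b, sumQuot_inl, Matrix.fromBlocks_apply₁₁, A, LinearMap.toMatrix_apply]
      apply sumQuot_repr_inl_of_mem
    | inr l => simp [b, LinearMap.toMatrix_apply, Matrix.fromBlocks_apply₁₂, B]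
  | inr j =>
    cases v with
    | inl k =>
      suffices W.mkQ (e (bW k)) = 0 by simp [LinearMap.toMatrix_apply, b, this]
      rw [← LinearMap.mem_ker, Submodule.ker_mkQ]
      exact he (Submodule.coe_mem (bW k))
    | inr l =>
      simp only [LinearMap.toMatrix_apply, sumQuot_repr_inr,
        Matrix.fromBlocks_apply₂₂, b, D]
      rw [← sumQuot_inr bW bQ l, W.mapQ_apply]
      simp

theorem exists_pow_eq_zero_of_mem_genKer {F V : Type*} [Field F] [AddCommGroup V] [Module F V]
    (f : V →ₗ[F] V) (v : V) (hv : v ∈ genKer f) : ∃ n : ℕ, (f ^ n) v = 0 := by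
  have h : genKer f ≤ ⨆ k : ℕ, LinearMap.ker (f ^ k) :=
    iSup₂_le fun k _ => le_iSup (fun k : ℕ => LinearMap.ker (f ^ k)) k
  have hm : Monotone fun k : ℕ => LinearMap.ker (f ^ k) := by
    intro a b hab x hx
    rw [LinearMap.mem_ker] at hx ⊢
    obtain ⟨c, rfl⟩ := Nat.exists_eq_add_of_le hab
    rw [add_comm, pow_add, Module.End.mul_apply, hx, map_zero]
  obtain ⟨n, hn⟩ := (Submodule.mem_iSup_of_directed _ hm.directed_le).1 (h hv)
  exact ⟨n, hn⟩

/-- the characteristic polynomial of `f` factors as `X ^ d` times the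
characteristic polynomial of the nonnilpotent part `f⁺`, where `d = dim genKer f`. -/
theorem charpoly_eq_X_pow_mul_charpoly_nonnilpotentPart {F V : Type*} [Field F]
    [AddCommGroup V] [Module F V] [FiniteDimensional F V] (f : V →ₗ[F] V) :
    LinearMap.charpoly f
      = Polynomial.X ^ (Module.finrank F (genKer f))
        * LinearMap.charpoly (nonnilpotentPart f) := by
  rw [charpoly_eq_restrict_mul_mapQ (genKer f) f (genKer_le_comap f)]
  congr 1
  rw [LinearMap.charpoly_eq_X_pow_iff]
  intro v
  obtain ⟨n, hn⟩ := exists_pow_eq_zero_of_mem_genKer f v v.2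
  refine ⟨n, Subtype.ext ?_⟩
  rw [Module.End.pow_restrict n]
  exact hn
end

section
/- Let F be a field, V a finite-dimensional vector space over F, and f : V → V a linear endomorphism. Let E = ⨅_{k ≥ 1} range(f^k) be the eventual range of f. Then f maps E onto E, the restriction of f to E is a linear automorphism of E, and the quotient map V → V / genKer(f) restricts to a linear isomorphism E → V / genKer(f) that conjugates f restricted to E with the nonnilpotent part f⁺. -/
/-- The eventual range (generalized image) of a linear endomorphism:
`⨅ k ≥ 1, range (f ^ k)`. -/
def evtRange {F V : Type*} [Field F] [AddCommGroup V] [Module F V] (f : V →ₗ[F] V) :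
    Submodule F V :=
  ⨅ k ≥ 1, LinearMap.range (f ^ k)

theorem evtRange_mapsTo {F V : Type*} [Field F] [AddCommGroup V] [Module F V]
    (f : V →ₗ[F] V) : ∀ x ∈ evtRange f, f x ∈ evtRange f := by
  intro x hx
  rw [evtRange] at hx ⊢
  simp only [Submodule.mem_iInf] at hx ⊢
  intro k hk
  obtain ⟨y, hy⟩ := hx k hk
  exact ⟨f y, by
    have hcomm : f ^ k * f = f * f ^ k := (pow_succ f k).symm.trans (pow_succ' f k)
    calc (f ^ k) (f y) = (f ^ k * f) y := rfl
      _ = (f * f ^ k) y := by rw [hcomm]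
      _ = f ((f ^ k) y) := rfl
      _ = f x := by rw [hy]⟩

theorem isCompl_genKer_evtRange {F V : Type*} [Field F] [AddCommGroup V] [Module F V]
    [FiniteDimensional F V] (f : V →ₗ[F] V) : IsCompl (genKer f) (evtRange f) := by
  have h := LinearMap.isCompl_iSup_ker_pow_iInf_range_pow f
  have h1 : genKer f = ⨆ n, LinearMap.ker (f ^ n) := by
    apply le_antisymm
    · exact iSup₂_le fun k _ => le_iSup (fun n => LinearMap.ker (f ^ n)) k
    · refine iSup_le fun k => ?_
      rcases Nat.eq_zero_or_pos k with rfl | hk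
      · intro x hx
        have : x = 0 := by simpa using hx
        rw [this]
        exact zero_mem _
      · exact le_iSup₂ (f := fun k (_ : k ≥ 1) => LinearMap.ker (f ^ k)) k hk
  have h2 : evtRange f = ⨅ n, LinearMap.range (f ^ n) := by
    apply le_antisymm
    · refine le_iInf fun k => ?_
      rcases Nat.eq_zero_or_pos k with rfl | hk
      · exact fun x _ => ⟨x, by simp⟩
      · exact iInf₂_le (f := fun k (_ : k ≥ 1) => LinearMap.range (f ^ k)) k hk
    · exact le_iInf₂ fun k _ => iInf_le (fun n => LinearMap.range (f ^ n)) k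
  rw [h1, h2]
  exact h

/-- for an endomorphism `f` of a finite-dimensional vector space, `f` maps
the eventual range `E` onto itself, the restriction of `f` to `E` is a linear automorphism,
and the quotient map `V → V ⧸ genKer f` restricts to a linear isomorphism
`E ≃ₗ V ⧸ genKer f` conjugating `f |_E` with the nonnilpotent part `f⁺`. -/
theorem evtRange_restrict_conjugate_nonnilpotentPart {F V : Type*} [Field F]
    [AddCommGroup V] [Module F V] [FiniteDimensional F V] (f : V →ₗ[F] V) :
    Submodule.map f (evtRange f) = evtRange f ∧
    Function.Bijective (f.restrict (evtRange_mapsTo f)) ∧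
    ∃ e : evtRange f ≃ₗ[F] V ⧸ genKer f,
      (∀ x : evtRange f, e x = Submodule.Quotient.mk (x : V)) ∧
      ∀ x : evtRange f,
        nonnilpotentPart f (e x) = e (f.restrict (evtRange_mapsTo f) x) := by
  have hc := isCompl_genKer_evtRange f
  have hinj : Function.Injective (f.restrict (evtRange_mapsTo f)) := by
    rw [injective_iff_map_eq_zero]
    intro x hx
    have hx0 : f (x : V) = 0 := congrArg Subtype.val hx
    have hk : (x : V) ∈ genKer f :=
      (le_iSup₂ (f := fun k (_ : k ≥ 1) => LinearMap.ker (f ^ k)) 1 le_rfl)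
        (by simpa using hx0)
    exact Subtype.ext (Submodule.disjoint_def.1 hc.disjoint _ hk x.2)
  have hsurj : Function.Surjective (f.restrict (evtRange_mapsTo f)) :=
    LinearMap.injective_iff_surjective.1 hinj
  refine ⟨?_, ⟨hinj, hsurj⟩, (Submodule.quotientEquivOfIsCompl _ _ hc).symm, ?_, ?_⟩
  · apply le_antisymm
    · rintro _ ⟨x, hx, rfl⟩
      exact evtRange_mapsTo f x hx
    · intro y hy
      obtain ⟨x, hx⟩ := hsurj ⟨y, hy⟩
      exact ⟨x, x.2, congrArg Subtype.val hx⟩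
  · intro x
    simp
  · intro x
    simp [nonnilpotentPart]
end
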